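/- Let 𝔖_f*(c,y) = ∏_{p ≤ y} (1 + p^{1−3c}·((p/(p−1))·((p−p^c)/(p−1))³ − 1)) · ∏_{p > y} (1 − 1/(p−1)²) (products over primes p). Then: (i) for every real c with 1/2 < c < 1, the infinite product 𝔖_f*(c) = ∏_p (1 + p^{1−3c}·((p/(p−1))·((p−p^c)/(p−1))³ − 1)) over all primes converges, and 𝔖_f*(c,y) → 𝔖_f*(c) as y → ∞; (ii) for every real c with 0 < c ≤ 1/2, 𝔖_f*(c,y) → 0 as y → ∞. -/

import Mathlib

noncomputable section

open Filter

/-- The primitive non-archimedean singular series `𝔖_f^*(c,y)`. -/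
def SfStar (c y : ℝ) : ℝ :=
  (∏ p ∈ Nat.primesBelow (⌊y⌋₊ + 1),
    (1 + (p : ℝ) ^ (1 - 3 * c) *
      (((p : ℝ) / ((p : ℝ) - 1)) * (((p : ℝ) - (p : ℝ) ^ c) / ((p : ℝ) - 1)) ^ 3 - 1))) *
  ∏' p : {p : ℕ // p.Prime ∧ y < (p : ℝ)}, (1 - 1 / (((p : ℕ) : ℝ) - 1) ^ 2)

/-- The deviation from `1` of the Euler factor at `p` of `𝔖_f^*(c)`. -/
def eulerTerm (c : ℝ) (p : ℕ) : ℝ :=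
  (p : ℝ) ^ (1 - 3 * c) *
    (((p : ℝ) / ((p : ℝ) - 1)) * (((p : ℝ) - (p : ℝ) ^ c) / ((p : ℝ) - 1)) ^ 3 - 1)

lemma eulerTerm_eq (c : ℝ) {p : ℕ} (hp : 2 ≤ p) :
    eulerTerm c p = (p : ℝ) ^ (1 - 3 * c) *
      ((1 - (p : ℝ) ^ (c - 1)) ^ 3 / (1 - (p : ℝ)⁻¹) ^ 4 - 1) := by
  have hp' : (2 : ℝ) ≤ p := by exact_mod_cast hp
  have h0 : (p : ℝ) ≠ 0 := by positivity
  have h1 : (p : ℝ) - 1 ≠ 0 := by linarith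
  have h2 : 1 - (p : ℝ)⁻¹ = ((p : ℝ) - 1) / p := by field_simp
  have h3 : (p : ℝ) ^ (c - 1) = (p : ℝ) ^ c / p := by
    rw [Real.rpow_sub (by positivity), Real.rpow_one]
  rw [eulerTerm, h2, h3]
  congr 2
  field_simp

lemma abs_cube_div_sub_one_le {x t : ℝ} (hx : 0 ≤ x) (hx' : x ≤ 1 / 2) (hxt : x ≤ t)
    (ht : t ≤ 1) : |(1 - t) ^ 3 / (1 - x) ^ 4 - 1| ≤ 112 * t := by
  have hd : (1 / 2 : ℝ) ^ 4 ≤ (1 - x) ^ 4 := by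
    gcongr
    linarith
  have hd0 : 0 < (1 - x) ^ 4 := by linarith
  have ht0 : 0 ≤ t := hx.trans hxt
  have h1 : (1 - x) ^ 4 ≤ 1 := pow_le_one₀ (by linarith) (by linarith)
  have h2 : (1 - t) ^ 3 ≤ 1 := pow_le_one₀ (by linarith) (by linarith)
  have h3 : 1 - 4 * x ≤ (1 - x) ^ 4 := by
    have := one_add_mul_le_pow (a := -x) (by linarith) 4
    norm_num at this
    linarith
  have h4 : 1 - 3 * t ≤ (1 - t) ^ 3 := by
    have := one_add_mul_le_pow (a := -t) (by linarith) 3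
    norm_num at this
    linarith
  have h5 : |(1 - t) ^ 3 - (1 - x) ^ 4| ≤ 7 * t := by
    rw [abs_le]
    constructor <;> linarith
  rw [div_sub_one hd0.ne', abs_div, abs_of_pos hd0, div_le_iff₀ hd0]
  nlinarith

lemma abs_eulerTerm_le {c : ℝ} (hc : 0 ≤ c) (hc' : c ≤ 1) {p : ℕ} (hp : 2 ≤ p) :
    |eulerTerm c p| ≤ 112 * (p : ℝ) ^ (-(2 * c)) := by
  have hp' : (2 : ℝ) ≤ p := by exact_mod_cast hp
  have h0 : (0 : ℝ) < p := by positivity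
  have h1 : (1 : ℝ) ≤ p := by linarith
  have hx : (p : ℝ)⁻¹ ≤ 1 / 2 := by
    rw [one_div]
    gcongr
  have hxt : (p : ℝ)⁻¹ ≤ (p : ℝ) ^ (c - 1) := by
    rw [← Real.rpow_neg_one]
    exact Real.rpow_le_rpow_of_exponent_le h1 (by linarith)
  have ht : (p : ℝ) ^ (c - 1) ≤ 1 := Real.rpow_le_one_of_one_le_of_nonpos h1 (by linarith)
  rw [eulerTerm_eq c hp, abs_mul, abs_of_pos (Real.rpow_pos_of_pos h0 _)]
  calc _ ≤ (p : ℝ) ^ (1 - 3 * c) * (112 * (p : ℝ) ^ (c - 1)) := by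
        gcongr
        exact abs_cube_div_sub_one_le (by positivity) hx hxt ht
    _ = 112 * ((p : ℝ) ^ (1 - 3 * c) * (p : ℝ) ^ (c - 1)) := by ring
    _ = _ := by
      rw [← Real.rpow_add h0]
      ring_nf

lemma cube_div_sub_one_le_neg {x t : ℝ} (hx : 0 ≤ x) (hx' : x < 1) (hxt : 4 * x ≤ t)
    (ht : t ≤ 1 / 3) : (1 - t) ^ 3 / (1 - x) ^ 4 - 1 ≤ -t := by
  have hd0 : 0 < (1 - x) ^ 4 := pow_pos (by linarith) 4
  have ht0 : 0 ≤ t := by linarith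
  have h1 : (1 - x) ^ 4 ≤ 1 := pow_le_one₀ (by linarith) (by linarith)
  have h3 : 1 - 4 * x ≤ (1 - x) ^ 4 := by
    have := one_add_mul_le_pow (a := -x) (by linarith) 4
    norm_num at this
    linarith
  have h4 : (1 - t) ^ 3 ≤ 1 - 2 * t := by
    nlinarith [mul_nonneg ht0 (sub_nonneg.2 ht), pow_nonneg ht0 3]
  rw [div_sub_one hd0.ne', div_le_iff₀ hd0]
  nlinarith

lemma eventually_eulerTerm_mem {c : ℝ} (hc : 0 < c) (hc' : c ≤ 1 / 2) :
    ∀ᶠ p : ℕ in atTop, -1 ≤ eulerTerm c p ∧ eulerTerm c p ≤ -(1 / (p : ℝ)) := by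
  have hpow {a : ℝ} (ha : 0 < a) : Tendsto (fun p : ℕ => (p : ℝ) ^ (-a)) atTop (nhds 0) :=
    (tendsto_rpow_neg_atTop ha).comp tendsto_natCast_atTop_atTop
  filter_upwards [eventually_ge_atTop 2,
    (hpow (by linarith : 0 < 2 * c)).eventually_le_const (by norm_num : (0 : ℝ) < 1 / 112),
    (hpow hc).eventually_le_const (by norm_num : (0 : ℝ) < 1 / 4),
    (hpow (by linarith : 0 < 1 - c)).eventually_le_const (by norm_num : (0 : ℝ) < 1 / 3)]
    with p hp h2c hcc h1c
  have hp' : (2 : ℝ) ≤ p := by exact_mod_cast hp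
  have h0 : (0 : ℝ) < p := by positivity
  refine ⟨?_, ?_⟩
  · have := (abs_le.1 (abs_eulerTerm_le hc.le (by linarith) hp)).1
    linarith
  · rw [neg_sub] at h1c
    have hxt : 4 * (p : ℝ)⁻¹ ≤ (p : ℝ) ^ (c - 1) := by
      have h : (p : ℝ)⁻¹ = (p : ℝ) ^ (c - 1) * (p : ℝ) ^ (-c) := by
        rw [← Real.rpow_add h0, ← Real.rpow_neg_one]
        ring_nf
      rw [h]
      nlinarith [Real.rpow_pos_of_pos h0 (c - 1)]
    rw [eulerTerm_eq c hp]
    calc _ ≤ (p : ℝ) ^ (1 - 3 * c) * (-(p : ℝ) ^ (c - 1)) := by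
          gcongr
          exact cube_div_sub_one_le_neg (by positivity) (inv_lt_one_of_one_lt₀ (by linarith))
            hxt h1c
      _ = -(p : ℝ) ^ (-(2 * c)) := by
          rw [mul_neg, ← Real.rpow_add h0]
          ring_nf
      _ ≤ -(1 / (p : ℝ)) := by
          rw [one_div, ← Real.rpow_neg_one]
          gcongr
          · linarith
          · linarith

lemma summable_prime_eulerTerm {c : ℝ} (hc : 1 / 2 < c) (hc' : c < 1) :
    Summable (fun p : {p : ℕ // p.Prime} => eulerTerm c p) := by
  have h : Summable (fun p : ℕ => 112 * (p : ℝ) ^ (-(2 * c))) :=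
    (Real.summable_nat_rpow.2 (by linarith)).mul_left 112
  exact .of_norm_bounded (h.comp_injective Subtype.val_injective)
    fun p => abs_eulerTerm_le (by linarith) hc'.le p.2.two_le

lemma tendsto_tprod_prime_gt :
    Tendsto (fun y : ℝ => ∏' p : {p : ℕ // p.Prime ∧ y < (p : ℝ)},
      (1 - 1 / (((p : ℕ) : ℝ) - 1) ^ 2)) atTop (nhds 1) := by
  classical
  let f (y : ℝ) (p : ℕ) : ℝ := if p.Prime ∧ y < p then -(1 / ((p : ℝ) - 1) ^ 2) else 0
  have hsum : Summable (fun p : ℕ => 1 / ((p : ℝ) - 1) ^ 2) := by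
    rw [← summable_nat_add_iff 1]
    simp only [Nat.cast_add, Nat.cast_one, add_sub_cancel_right]
    exact Real.summable_one_div_nat_pow.2 one_lt_two
  have hlim (p : ℕ) : Tendsto (f · p) atTop (nhds 0) := by
    refine tendsto_const_nhds.congr' ?_
    filter_upwards [eventually_ge_atTop (p : ℝ)] with y hy
    simp [f, hy.not_gt]
  have hbound : ∀ᶠ y in atTop, ∀ p, ‖f y p‖ ≤ 1 / ((p : ℝ) - 1) ^ 2 := by
    refine .of_forall fun y p => ?_
    simp only [f]
    split_ifs
    · rw [norm_neg, Real.norm_of_nonneg (by positivity)]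
    · rw [norm_zero]
      positivity
  have h := tendsto_tprod_one_add_of_dominated_convergence hsum hlim hbound
  simp only [add_zero, tprod_one] at h
  refine h.congr fun y => ?_
  refine .trans (tprod_congr fun p => ?_)
    (tprod_subtype {p : ℕ | p.Prime ∧ y < p} (fun p : ℕ => 1 - 1 / ((p : ℝ) - 1) ^ 2)).symm
  by_cases hp : p.Prime ∧ y < p <;> simp [f, Set.mulIndicator, hp, sub_eq_add_neg]

lemma tendsto_floor_add_one : Tendsto (fun y : ℝ => ⌊y⌋₊ + 1) atTop atTop :=
  (tendsto_add_atTop_nat 1).comp tendsto_nat_floor_atTop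

lemma tendsto_SfStar {c L : ℝ}
    (h : Tendsto (fun n => ∏ p ∈ Nat.primesBelow n, (1 + eulerTerm c p)) atTop (nhds L)) :
    Tendsto (SfStar c) atTop (nhds L) := by
  have h' := (h.comp tendsto_floor_add_one).mul tendsto_tprod_prime_gt
  rwa [mul_one] at h'

lemma tendsto_prod_primesBelow {f : ℕ → ℝ} {L : ℝ}
    (h : HasProd (fun p : {p : ℕ // p.Prime} => f p) L) :
    Tendsto (fun n => ∏ p ∈ Nat.primesBelow n, f p) atTop (nhds L) := by
  refine ((Nat.Primes.hasProd_iff_hasProd_ite f).1 h).tendsto_prod_nat.congr fun n => ?_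
  rw [Nat.primesBelow_eq_filter_range, Finset.prod_filter]

lemma tendsto_sum_primesBelow_one_div :
    Tendsto (fun n => ∑ p ∈ Nat.primesBelow n, 1 / (p : ℝ)) atTop atTop := by
  refine ((not_summable_iff_tendsto_nat_atTop_of_nonneg fun n => ?_).1
    not_summable_one_div_on_primes).congr fun n => ?_
  · exact Set.indicator_nonneg (fun _ _ => by positivity) n
  · simp only [Nat.primesBelow_eq_filter_range, Finset.sum_filter, Set.indicator_apply,
      Set.mem_ofPred_eq]

lemma tendsto_prod_primesBelow_zero {a : ℕ → ℝ}
    (ha : ∀ᶠ p : ℕ in atTop, -1 ≤ a p ∧ a p ≤ -(1 / (p : ℝ))) :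
    Tendsto (fun n => ∏ p ∈ Nat.primesBelow n, (1 + a p)) atTop (nhds 0) := by
  obtain ⟨N, hN⟩ := eventually_atTop.1 ha
  let P (n : ℕ) : ℝ := ∏ p ∈ Nat.primesBelow n, (1 + a p)
  let S (n : ℕ) : ℝ := ∑ p ∈ Nat.primesBelow n, 1 / (p : ℝ)
  have key : ∀ n ≥ N, |P n| ≤ |P N| * Real.exp (S N - S n) := by
    intro n hn
    induction n, hn using Nat.le_induction with
    | base => simp
    | succ n hn ih =>
      by_cases hp : n.Prime
      · have hP : P (n + 1) = (1 + a n) * P n := by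
          simp only [P, Nat.primesBelow_succ, hp, if_true]
          exact Finset.prod_insert (Nat.notMem_primesBelow n)
        have hS : S (n + 1) = 1 / (n : ℝ) + S n := by
          simp only [S, Nat.primesBelow_succ, hp, if_true]
          exact Finset.sum_insert (Nat.notMem_primesBelow n)
        obtain ⟨h1, h2⟩ := hN n hn
        have h3 : |1 + a n| ≤ Real.exp (-(1 / (n : ℝ))) := by
          rw [abs_of_nonneg (by linarith)]
          linarith [Real.add_one_le_exp (-(1 / (n : ℝ)))]
        calc |P (n + 1)| = |1 + a n| * |P n| := by rw [hP, abs_mul]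
          _ ≤ Real.exp (-(1 / (n : ℝ))) * (|P N| * Real.exp (S N - S n)) := by gcongr
          _ = |P N| * (Real.exp (-(1 / (n : ℝ))) * Real.exp (S N - S n)) := by ring
          _ = |P N| * Real.exp (S N - S (n + 1)) := by
            rw [← Real.exp_add, hS]
            ring_nf
      · have hn' : Nat.primesBelow (n + 1) = Nat.primesBelow n := by
          simp [Nat.primesBelow_succ, hp]
        simpa only [P, S, hn'] using ih
  have hS : Tendsto (fun n => S N - S n) atTop atBot := by
    simpa only [sub_eq_add_neg, Function.comp_apply] using! tendsto_atBot_add_const_left _ (S N)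
      (tendsto_neg_atTop_atBot.comp tendsto_sum_primesBelow_one_div)
  have hE : Tendsto (fun n => |P N| * Real.exp (S N - S n)) atTop (nhds 0) := by
    simpa only [mul_zero, Function.comp_apply] using (Real.tendsto_exp_atBot.comp hS).const_mul |P N|
  exact squeeze_zero_norm' (eventually_atTop.2 ⟨N, key⟩) hE

theorem singular_series_limit :
    (∀ c : ℝ, 1 / 2 < c → c < 1 →
      Multipliable (fun p : {p : ℕ // p.Prime} =>
        (1 + ((p : ℕ) : ℝ) ^ (1 - 3 * c) *
          ((((p : ℕ) : ℝ) / (((p : ℕ) : ℝ) - 1)) *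
            ((((p : ℕ) : ℝ) - ((p : ℕ) : ℝ) ^ c) / (((p : ℕ) : ℝ) - 1)) ^ 3 - 1))) ∧
      Tendsto (fun y : ℝ => SfStar c y) atTop
        (nhds (∏' p : {p : ℕ // p.Prime},
          (1 + ((p : ℕ) : ℝ) ^ (1 - 3 * c) *
            ((((p : ℕ) : ℝ) / (((p : ℕ) : ℝ) - 1)) *
              ((((p : ℕ) : ℝ) - ((p : ℕ) : ℝ) ^ c) / (((p : ℕ) : ℝ) - 1)) ^ 3 - 1))))) ∧
    (∀ c : ℝ, 0 < c → c ≤ 1 / 2 →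
      Tendsto (fun y : ℝ => SfStar c y) atTop (nhds 0)) := by
  refine ⟨fun c hc hc' => ?_, fun c hc hc' => ?_⟩
  · have h : Multipliable (fun p : {p : ℕ // p.Prime} => 1 + eulerTerm c p) :=
      multipliable_one_add_of_summable (summable_prime_eulerTerm hc hc').norm
    exact ⟨h, tendsto_SfStar (tendsto_prod_primesBelow (f := fun p => 1 + eulerTerm c p) h.hasProd)⟩
  · exact tendsto_SfStar (tendsto_prod_primesBelow_zero (eventually_eulerTerm_mem hc hc'))
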